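/- Let α ∈ (1,2), T > 0, u₀ ∈ D(√A), u₁ ∈ H, let u(t) = Σ_{n=1}^∞ [ ⟨u₀,e_n⟩ E_{α,1}(−λ_n t^α) + ⟨u₁,e_n⟩ t E_{α,2}(−λ_n t^α) ] e_n and u'(t) = Σ_{n=1}^∞ [ −λ_n ⟨u₀,e_n⟩ t^{α−1} E_{α,α}(−λ_n t^α) + ⟨u₁,e_n⟩ E_{α,1}(−λ_n t^α) ] e_n. Then for every v ∈ D(√A) the map t ↦ ⟨I^{2−α}(u' − u₁)(t), v⟩ is continuously differentiable on [0,T] and satisfies d/dt ⟨I^{2−α}(u' − u₁)(t), v⟩ + ⟨√A u(t), √A v⟩ = 0 for all t ∈ [0,T]. -/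

import Mathlib

open scoped RealInnerProductSpace

/-- The Mittag-Leffler function `E_{α,β}(x) = ∑_{k=0}^∞ x^k / Γ(αk + β)` (real argument). -/
noncomputable def ML (α β x : ℝ) : ℝ :=
  ∑' k : ℕ, x ^ k / Real.Gamma (α * (k : ℝ) + β)

/-- The Riemann–Liouville fractional integral of order `β` of an `H`-valued function:
`I^β(f)(t) = (1/Γ(β)) ∫_0^t (t−τ)^{β−1} f(τ) dτ`. -/
noncomputable def riemannLiouville {H : Type*} [NormedAddCommGroup H] [NormedSpace ℝ H]
    (β : ℝ) (f : ℝ → H) (t : ℝ) : H :=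
  (Real.Gamma β)⁻¹ • ∫ τ in (0 : ℝ)..t, ((t - τ) ^ (β - 1)) • f τ

section Helpers

open Set Filter Topology MeasureTheory


theorem beta_int {s g t : ℝ} (hs : 0 < s) (hg : 0 < g) (ht : 0 < t) :
    ∫ τ in (0:ℝ)..t, (t - τ) ^ (g - 1) * τ ^ (s - 1)
      = t ^ (s + g - 1) * (Real.Gamma s * Real.Gamma g / Real.Gamma (s + g)) := by
  have h := Complex.betaIntegral_scaled (s : ℂ) (g : ℂ) ht
  rw [Complex.betaIntegral_eq_Gamma_mul_div _ _ (by simpa) (by simpa)] at h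
  rw [← Complex.ofReal_add, Complex.Gamma_ofReal, Complex.Gamma_ofReal, Complex.Gamma_ofReal] at h
  apply Complex.ofReal_injective
  rw [← intervalIntegral.integral_ofReal]
  push_cast
  have e1 : ((t ^ (s + g - 1) : ℝ) : ℂ) = (t:ℂ) ^ ((s:ℂ) + g - 1) := by
    rw [Complex.ofReal_cpow ht.le]; push_cast; rfl
  rw [e1]
  rw [Complex.ofReal_add] at h
  rw [← h]
  apply intervalIntegral.integral_congr
  intro x hx
  rw [uIcc_of_le ht.le] at hx
  simp only
  rw [Complex.ofReal_cpow (by linarith [hx.2]), Complex.ofReal_cpow hx.1]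
  push_cast
  ring

theorem beta_intble {s g t : ℝ} (hs : 0 < s) (hg : 0 < g) (ht : 0 < t) :
    IntervalIntegrable (fun τ => (t - τ) ^ (g - 1) * τ ^ (s - 1)) volume 0 t := by
  by_contra h
  have := intervalIntegral.integral_undef h
  rw [beta_int hs hg ht] at this
  have h1 := Real.Gamma_pos_of_pos hs
  have h2 := Real.Gamma_pos_of_pos hg
  have h3 := Real.Gamma_pos_of_pos (add_pos hs hg)
  have : 0 < t ^ (s + g - 1) * (Real.Gamma s * Real.Gamma g / Real.Gamma (s + g)) := by positivity
  linarith

/-- coefficients of an entire power series -/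
def Ent (a : ℕ → ℝ) : Prop := ∀ R : ℝ, 0 ≤ R → Summable fun k => |a k| * R ^ k

/-- power series -/
noncomputable def PS (a : ℕ → ℝ) (x : ℝ) : ℝ := ∑' k, a k * x ^ k

/-- generalized power series -/
noncomputable def gp (α : ℝ) (a : ℕ → ℝ) (μ t : ℝ) : ℝ := t ^ μ * PS a (t ^ α)

theorem Ent.abs_summable {a : ℕ → ℝ} (h : Ent a) (x : ℝ) : Summable fun k => |a k * x ^ k| := by
  simpa [abs_mul, abs_pow] using h |x| (abs_nonneg x)

theorem Ent.summable {a : ℕ → ℝ} (h : Ent a) (x : ℝ) : Summable fun k => a k * x ^ k :=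
  (h.abs_summable x).of_abs

theorem Ent.of_le {a b : ℕ → ℝ} (h : Ent a) (C : ℝ) (hb : ∀ k, |b k| ≤ C * |a k|) : Ent b := by
  intro R hR
  refine Summable.of_nonneg_of_le (fun k => by positivity) (fun k => ?_) ((h R hR).mul_left C)
  rw [← mul_assoc]
  exact mul_le_mul_of_nonneg_right (hb k) (by positivity)

theorem Ent.lin {a : ℕ → ℝ} (h : Ent a) (p q : ℝ) : Ent (fun k => (p * k + q) * a k) := by
  intro R hR
  refine Summable.of_nonneg_of_le (fun k => by positivity) (fun k => ?_)
    ((h (2*R) (by positivity)).mul_left (|p| + |q|))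
  have h2 : (k : ℝ) ≤ 2 ^ k := by exact_mod_cast (Nat.lt_two_pow_self (n := k)).le
  have h3 : (1 : ℝ) ≤ 2 ^ k := one_le_pow₀ (by norm_num)
  have h1 : |p * k + q| ≤ (|p| + |q|) * 2 ^ k := by
    refine (abs_add_le _ _).trans ?_
    rw [abs_mul, Nat.abs_cast]
    nlinarith [abs_nonneg p, abs_nonneg q]
  rw [abs_mul, mul_pow]
  calc |p * k + q| * |a k| * R ^ k ≤ ((|p| + |q|) * 2 ^ k) * |a k| * R ^ k := by gcongr
    _ = _ := by ring

theorem Ent.scale {a : ℕ → ℝ} (h : Ent a) (c : ℝ) : Ent (fun k => c ^ k * a k) := by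
  intro R hR
  refine (h (|c| * R) (by positivity)).congr (fun k => ?_)
  rw [abs_mul, abs_pow, mul_pow]; ring

/-- Cauchy product of coefficient sequences -/
noncomputable def cp (a b : ℕ → ℝ) (n : ℕ) : ℝ :=
  Finset.sum (Finset.HasAntidiagonal.antidiagonal n) (fun kl : ℕ × ℕ => a kl.1 * b kl.2)

theorem Ent.cauchy {a b : ℕ → ℝ} (ha : Ent a) (hb : Ent b) :
    Ent (cp a b) := by
  intro R hR
  have := summable_norm_sum_mul_antidiagonal_of_summable_norm
    (f := fun k => a k * R ^ k) (g := fun k => b k * R ^ k) (ha.abs_summable R) (hb.abs_summable R)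
  refine this.congr (fun n => ?_)
  rw [Real.norm_eq_abs, ← abs_of_nonneg (pow_nonneg hR n), ← abs_mul,
    cp, Finset.sum_mul]
  congr 1
  refine Finset.sum_congr rfl ?_
  intro kl h
  have hk : kl.1 + kl.2 = n := by simpa using h
  rw [← hk, pow_add]; ring

theorem PS_mul {a b : ℕ → ℝ} (ha : Ent a) (hb : Ent b) (x : ℝ) :
    PS a x * PS b x = PS (cp a b) x := by
  unfold PS
  rw [tsum_mul_tsum_eq_tsum_sum_antidiagonal_of_summable_norm
    (f := fun k => a k * x ^ k) (g := fun k => b k * x ^ k) (ha.abs_summable x)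
    (hb.abs_summable x)]
  refine tsum_congr (fun n => ?_)
  rw [cp, Finset.sum_mul]
  refine Finset.sum_congr rfl ?_
  intro kl h
  have hk : kl.1 + kl.2 = n := by simpa using h
  rw [← hk, pow_add]; ring

theorem PS_hasDerivAt {a : ℕ → ℝ} (ha : Ent a) (x : ℝ) :
    HasDerivAt (PS a) (∑' k : ℕ, a k * (k * x ^ (k - 1))) x := by
  set R := |x| + 1 with hR
  have hR0 : 0 < R := by positivity
  have hsum : Summable fun k : ℕ => |a k| * (k * R ^ (k-1)) := by
    have h := (ha.lin 1 0) R hR0.le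
    refine (h.mul_left R⁻¹).congr (fun k => ?_)
    rcases k with _ | k
    · simp
    · simp only [one_mul, add_zero, abs_mul, Nat.abs_cast, Nat.add_sub_cancel]
      field_simp
      ring
  refine hasDerivAt_tsum_of_isPreconnected (t := Metric.ball 0 R) (y₀ := x) hsum
    Metric.isOpen_ball (convex_ball _ _).isPreconnected
    (fun n y _ => (hasDerivAt_pow n y).const_mul (a n)) (fun n y hy => ?_) ?_ (ha.summable x) ?_
  · rw [mem_ball_zero_iff, Real.norm_eq_abs] at hy
    rw [Real.norm_eq_abs, abs_mul, abs_mul, abs_pow, Nat.abs_cast]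
    gcongr
  · simp [hR]
  · simp [hR]

theorem PS_continuous {a : ℕ → ℝ} (ha : Ent a) : Continuous (PS a) :=
  continuous_iff_continuousAt.2 fun x => (PS_hasDerivAt ha x).continuousAt

theorem gp_continuous {α μ : ℝ} {a : ℕ → ℝ} (ha : Ent a) (hα : 0 ≤ α) (hμ : 0 ≤ μ) :
    Continuous (gp α a μ) :=
  (Real.continuous_rpow_const hμ).mul ((PS_continuous ha).comp (Real.continuous_rpow_const hα))

theorem gp_continuousOn {α μ : ℝ} {a : ℕ → ℝ} (ha : Ent a) (hα : 0 ≤ α) :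
    ContinuousOn (gp α a μ) (Ioi 0) :=
  (continuousOn_id.rpow_const (fun _ hx => Or.inl (ne_of_gt hx))).mul
    ((PS_continuous ha).comp (Real.continuous_rpow_const hα)).continuousOn

theorem gp_hasDerivAt {α μ t : ℝ} {a : ℕ → ℝ} (ha : Ent a) (ht : 0 < t) :
    HasDerivAt (gp α a μ) (gp α (fun k => (α * k + μ) * a k) (μ - 1) t) t := by
  have h1 := Real.hasDerivAt_rpow_const (x := t) (p := μ) (Or.inl ht.ne')
  have h2 := Real.hasDerivAt_rpow_const (x := t) (p := α) (Or.inl ht.ne')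
  have h3 := (PS_hasDerivAt ha (t ^ α)).comp t h2
  have h4 := h1.mul h3
  refine h4.congr_deriv ?_
  simp only [gp, PS, Function.comp]
  have hx : 0 < t ^ α := by positivity
  have e1 : t ^ μ = t ^ (μ - 1) * t := by
    rw [← Real.rpow_add_one ht.ne']; congr 1; ring
  have e2 : t ^ (α - 1) * t = t ^ α := by
    rw [← Real.rpow_add_one ht.ne']; congr 1; ring
  have s1 := ha.summable (t ^ α)
  have s2 := (ha.lin 1 0).summable (t ^ α)
  have e3 : (∑' k : ℕ, a k * (k * (t ^ α) ^ (k - 1))) * t ^ α =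
      ∑' k : ℕ, (1 * k + 0) * a k * (t ^ α) ^ k := by
    rw [← tsum_mul_right]
    refine tsum_congr (fun k => ?_)
    rcases k with _ | k
    · simp
    · simp only [Nat.add_sub_cancel]; push_cast; ring
  calc _ = t ^ (μ - 1) * (μ * (∑' k : ℕ, a k * (t ^ α) ^ k) +
        α * ((∑' k : ℕ, a k * (k * (t ^ α) ^ (k - 1))) * (t ^ (α - 1) * t))) := by
        rw [e1]; ring
    _ = _ := by
      rw [e2, e3, ← tsum_mul_left, ← tsum_mul_left, ← (s1.mul_left μ).tsum_add (s2.mul_left α)]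
      congr 1
      refine tsum_congr (fun k => ?_)
      ring


theorem ratio_bound {s₀ s g : ℝ} (hs₀ : 0 < s₀) (hs : s₀ ≤ s) (hg : 0 < g) :
    Real.Gamma s / Real.Gamma (s + g) ≤ Real.Gamma s₀ / Real.Gamma (s₀ + g) := by
  have h0 : 0 < s := by linarith
  have h : ∫ τ in (0:ℝ)..1, (1 - τ) ^ (g - 1) * τ ^ (s - 1) ≤
      ∫ τ in (0:ℝ)..1, (1 - τ) ^ (g - 1) * τ ^ (s₀ - 1) := by
    refine intervalIntegral.integral_mono_on_of_le_Ioo zero_le_one (beta_intble h0 hg one_pos)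
      (beta_intble hs₀ hg one_pos) (fun x hx => ?_)
    have h1 : 0 ≤ 1 - x := by linarith [hx.2]
    exact mul_le_mul_of_nonneg_left (Real.rpow_le_rpow_of_exponent_ge hx.1 hx.2.le (by linarith))
      (by positivity)
  rw [beta_int h0 hg one_pos, beta_int hs₀ hg one_pos] at h
  have h2 := Real.Gamma_pos_of_pos hg
  simp only [Real.one_rpow, one_mul] at h
  rw [mul_div_right_comm, mul_div_right_comm] at h
  exact le_of_mul_le_mul_right h h2

theorem Ent.ratio {a : ℕ → ℝ} (ha : Ent a) {α s g : ℝ} (hα : 0 ≤ α) (hs : 0 < s) (hg : 0 < g) :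
    Ent (fun k => a k * (Real.Gamma (α * k + s) / Real.Gamma (α * k + s + g))) := by
  refine ha.of_le (Real.Gamma s / Real.Gamma (s + g)) (fun k => ?_)
  have h1 : 0 < α * k + s := by positivity
  have h2 := Real.Gamma_pos_of_pos h1
  have h3 := Real.Gamma_pos_of_pos (add_pos h1 hg)
  rw [abs_mul, mul_comm, abs_of_pos (div_pos h2 h3)]
  exact mul_le_mul_of_nonneg_right (ratio_bound hs (by nlinarith [(Nat.cast_nonneg k : (0:ℝ) ≤ k)]) hg)
    (abs_nonneg _)

theorem rpow_split {α μ τ : ℝ} (hτ : 0 < τ) (k : ℕ) : τ ^ (α * k + μ) = τ ^ μ * (τ ^ α) ^ k := by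
  rw [Real.rpow_add hτ, Real.rpow_mul hτ.le, Real.rpow_natCast, mul_comm]

theorem gp_intble {α μ g t : ℝ} {a : ℕ → ℝ} (ha : Ent a) (hα : 0 ≤ α) (hμ : -1 < μ) (hg : 0 < g)
    (ht : 0 < t) :
    IntervalIntegrable (fun τ => (t - τ) ^ (g - 1) * gp α a μ τ) volume 0 t := by
  have h1 := (beta_intble (s := μ + 1) (by linarith) hg ht).mul_continuousOn
    ((PS_continuous ha).comp (Real.continuous_rpow_const hα)).continuousOn
  simpa [gp, mul_assoc] using h1

theorem rl_gp {α μ g t : ℝ} {a : ℕ → ℝ} (ha : Ent a) (hα : 0 ≤ α) (hμ : -1 < μ) (hg : 0 < g)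
    (ht : 0 < t) :
    riemannLiouville g (gp α a μ) t =
      gp α (fun k => a k * (Real.Gamma (α * k + (μ + 1)) / Real.Gamma (α * k + (μ + 1) + g)))
        (μ + g) t := by
  have hG := Real.Gamma_pos_of_pos hg
  have hsk : ∀ k : ℕ, 0 < α * k + (μ + 1) := fun k => by
    have : 0 ≤ α * k := by positivity
    linarith
  have hE := ha.ratio hα (s := μ + 1) (by linarith) hg
  let F : ℕ → ℝ → ℝ := fun k τ => a k * ((t - τ) ^ (g - 1) * τ ^ (α * k + (μ + 1) - 1))
  have hint : ∀ k, Integrable (F k) (volume.restrict (Ioc 0 t)) := fun k => by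
    have := (beta_intble (hsk k) hg ht).const_mul (a k)
    rwa [intervalIntegrable_iff_integrableOn_Ioc_of_le ht.le] at this
  have hval : ∀ k : ℕ, ∫ τ in Ioc 0 t, (t - τ) ^ (g - 1) * τ ^ (α * k + (μ + 1) - 1) =
      t ^ (μ + g) * Real.Gamma g * ((Real.Gamma (α * k + (μ + 1)) / Real.Gamma (α * k + (μ + 1) + g))
        * (t ^ α) ^ k) := fun k => by
    rw [← intervalIntegral.integral_of_le ht.le, beta_int (hsk k) hg ht]
    rw [show α * k + (μ + 1) + g - 1 = α * k + (μ + g) by ring, rpow_split ht]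
    ring
  have hnorm : ∀ k, ∫ τ in Ioc 0 t, ‖F k τ‖ = t ^ (μ + g) * Real.Gamma g *
      (|a k * (Real.Gamma (α * k + (μ + 1)) / Real.Gamma (α * k + (μ + 1) + g))|
        * (t ^ α) ^ k) := fun k => by
    have h1 : ∫ τ in Ioc 0 t, ‖F k τ‖ = ∫ τ in Ioc 0 t, |a k| *
        ((t - τ) ^ (g - 1) * τ ^ (α * k + (μ + 1) - 1)) := by
      refine setIntegral_congr_fun measurableSet_Ioc (fun τ hτ => ?_)
      have h1 : 0 ≤ t - τ := by linarith [hτ.2]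
      have h2 : 0 ≤ τ := hτ.1.le
      simp only [F, Real.norm_eq_abs]
      rw [abs_mul, abs_of_nonneg (a := _ * _) (by positivity)]
    have h2 := Real.Gamma_pos_of_pos (hsk k)
    have h3 := Real.Gamma_pos_of_pos (add_pos (hsk k) hg)
    rw [h1, integral_const_mul, hval, abs_mul, abs_of_pos (div_pos h2 h3)]
    ring
  have hsum : Summable fun k => ∫ τ in Ioc 0 t, ‖F k τ‖ := by
    simp_rw [hnorm]
    exact (hE (t ^ α) (by positivity)).mul_left _
  have key := (hasSum_integral_of_summable_integral_norm hint hsum).tsum_eq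
  have e1 : ∫ τ in Ioc 0 t, ∑' k, F k τ = ∫ τ in (0:ℝ)..t, (t - τ) ^ (g - 1) • gp α a μ τ := by
    rw [intervalIntegral.integral_of_le ht.le]
    refine setIntegral_congr_fun measurableSet_Ioc (fun τ hτ => ?_)
    simp only [gp, PS, smul_eq_mul, F]
    rw [← mul_assoc, ← tsum_mul_left]
    refine tsum_congr (fun k => ?_)
    rw [show α * k + (μ + 1) - 1 = α * k + μ by ring, rpow_split hτ.1]
    ring
  unfold riemannLiouville
  rw [← e1, ← key]
  simp only [F, integral_const_mul, hval, gp, PS, smul_eq_mul]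
  rw [← tsum_mul_left, ← tsum_mul_left]
  refine tsum_congr (fun k => ?_)
  field_simp

theorem rl_zero (g : ℝ) (f : ℝ → ℝ) : riemannLiouville g f 0 = 0 := by
  simp [riemannLiouville]

theorem gp_zero {α μ : ℝ} {a : ℕ → ℝ} (hμ : μ ≠ 0) : gp α a μ 0 = 0 := by
  simp [gp, Real.zero_rpow hμ]

/-- Alikhanov inequality -/
theorem alikhanov {b t : ℝ} {q q' : ℝ → ℝ} (hb0 : 0 ≤ b) (hb1 : b < 1) (ht : 0 < t)
    (hq : ContinuousOn q (Icc 0 t)) (hd : ∀ τ, 0 < τ → HasDerivAt q (q' τ) τ)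
    (hi : IntervalIntegrable (fun τ => (t - τ) ^ (-b) * (q' τ * (q t - q τ))) volume 0 t) :
    0 ≤ ∫ τ in (0:ℝ)..t, (t - τ) ^ (-b) * (q' τ * (q t - q τ)) := by
  let φ : ℝ → ℝ := fun τ => (t - τ) ^ (-b) * (-(q t - q τ) ^ 2 / 2)
  have hcont : ContinuousOn φ (Icc 0 t) := by
    intro τ hτ
    rcases eq_or_lt_of_le hτ.2 with h | h
    · subst h
      -- continuity at the end point
      have h1 : Tendsto (fun x => slope q τ x) (𝓝[≠] τ) (𝓝 (q' τ)) := (hd τ ht).tendsto_slope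
      have h2 : Tendsto (fun x => q τ - q x) (𝓝[≠] τ) (𝓝 0) := by
        have := ((hd τ ht).continuousAt.tendsto.mono_left nhdsWithin_le_nhds : 
          Tendsto q (𝓝[≠] τ) (𝓝 (q τ))).const_sub (q τ)
        simpa using this
      have h3 : Tendsto (fun x => (τ - x) ^ (1 - b)) (𝓝[≠] τ) (𝓝 0) := by
        have hc : Continuous fun x => (τ - x) ^ (1 - b) :=
          (Real.continuous_rpow_const (by linarith)).comp (continuous_const.sub continuous_id)
        have := hc.tendsto τ
        simp only [sub_self, Real.zero_rpow (by linarith : 1 - b ≠ 0)] at this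
        exact this.mono_left nhdsWithin_le_nhds
      have h4 := (((h3.mul h1).mul h2).mul_const (-1/2))
      have h5 : Tendsto φ (𝓝[Icc 0 τ \ {τ}] τ) (𝓝 (φ τ)) := by
        have e0 : φ τ = 0 * q' τ * 0 * (-1/2) := by simp [φ]
        rw [e0]
        refine (h4.mono_left (nhdsWithin_mono _ (fun x hx => hx.2))).congr' ?_
        filter_upwards [self_mem_nhdsWithin] with x hx
        have hx1 : x < τ := lt_of_le_of_ne hx.1.2 hx.2
        have hx2 : 0 < τ - x := by linarith
        simp only [φ, slope_def_field]
        rw [show (1 - b) = -b + 1 by ring, Real.rpow_add_one hx2.ne']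
        have : x - τ ≠ 0 := by linarith
        field_simp
        ring
      exact continuousWithinAt_sdiff_self.1 h5
    · have h1 : t - τ ≠ 0 := by linarith
      have hc : ContinuousWithinAt (fun x => t - x) (Icc 0 t) τ := 
        (continuous_const.sub continuous_id).continuousWithinAt
      exact (hc.rpow_const (Or.inl h1)).mul
        ((((continuousWithinAt_const.sub (hq τ hτ)).pow 2).neg).div_const 2)
  have hder : ∀ τ ∈ Ioo 0 t, HasDerivWithinAt φ
      ((t - τ) ^ (-b) * (q' τ * (q t - q τ)) - b * (t - τ) ^ (-b - 1) * ((q t - q τ) ^ 2 / 2))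
      (Ioi τ) τ := by
    intro τ hτ
    have h1 : t - τ ≠ 0 := by linarith [hτ.2]
    have hA : HasDerivAt (fun x => (t - x) ^ (-b)) (-1 * (-b) * (t - τ) ^ (-b - 1)) τ :=
      HasDerivAt.rpow_const (by simpa using (hasDerivAt_id τ).const_sub t) (Or.inl h1)
    have hB : HasDerivAt (fun x => -(q t - q x) ^ 2 / 2) (q' τ * (q t - q τ)) τ := by
      have := ((((hd τ hτ.1).const_sub (q t)).pow 2).neg).div_const 2
      refine this.congr_deriv ?_
      simp; ring
    refine ((hA.mul hB).congr_deriv ?_).hasDerivWithinAt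
    ring
  have := intervalIntegral.sub_le_integral_of_hasDeriv_right_of_le ht.le hcont hder
    ((intervalIntegrable_iff_integrableOn_Icc_of_le ht.le).1 hi) (fun τ hτ => by
      have h1 : 0 < t - τ := by linarith [hτ.2]
      have : 0 ≤ b * (t - τ) ^ (-b - 1) * ((q t - q τ) ^ 2 / 2) := by positivity
      linarith)
  refine le_trans ?_ this
  simp only [φ, sub_self, sub_zero]
  have : 0 ≤ t ^ (-b) * ((q t - q 0) ^ 2 / 2) := by positivity
  nlinarith


theorem rl_congr {g t : ℝ} (ht : 0 ≤ t) {f h : ℝ → ℝ} (hfh : ∀ τ, 0 < τ → f τ = h τ) :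
    riemannLiouville g f t = riemannLiouville g h t := by
  unfold riemannLiouville
  congr 1
  rw [intervalIntegral.integral_of_le ht, intervalIntegral.integral_of_le ht]
  refine setIntegral_congr_fun measurableSet_Ioc (fun τ hτ => ?_)
  simp only [hfh τ hτ.1]

theorem gp_congr {α μ ν t : ℝ} {a b : ℕ → ℝ} (h : ∀ k, a k = b k) (h' : μ = ν) :
    gp α a μ t = gp α b ν t := by
  rw [funext h, h']

theorem gp_sq {α μ τ : ℝ} {a : ℕ → ℝ} (ha : Ent a) (hτ : 0 < τ) :
    gp α a μ τ ^ 2 = gp α (cp a a) (2 * μ) τ := by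
  unfold gp
  rw [← PS_mul ha ha, two_mul, Real.rpow_add hτ]; ring

/-- derivative coefficients -/
theorem energy {α : ℝ} (h1 : 1 < α) (h2 : α < 2) {a : ℕ → ℝ} (ha : Ent a) :
    (ContinuousOn (riemannLiouville (2 - α) (fun τ => gp α a (α - 1) τ ^ 2)) (Ici 0)) ∧
    ∀ t, 0 < t → ∃ J', HasDerivAt (riemannLiouville (2 - α) (fun τ => gp α a (α - 1) τ ^ 2)) J' t ∧
      J' ≤ 2 * gp α a (α - 1) t *
        gp α (fun k => a k * (Real.Gamma (α * k + α) / Real.Gamma (α * k + 1))) 0 t := by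
  have hα : 0 ≤ α := by linarith
  have hg : 0 < 2 - α := by linarith
  have hc := ha.cauchy ha
  have hB := hc.ratio hα (s := 2 * (α - 1) + 1) (by linarith) hg
  have hJ : ∀ t, 0 < t → riemannLiouville (2 - α) (fun τ => gp α a (α - 1) τ ^ 2) t =
      gp α _ (2 * (α - 1) + (2 - α)) t := fun t ht => by
    rw [rl_congr ht.le (fun τ hτ => gp_sq (α := α) (μ := α - 1) ha hτ)]
    exact rl_gp hc hα (by linarith) hg ht
  constructor
  · refine (gp_continuous hB hα (μ := 2 * (α - 1) + (2 - α)) (by linarith)).continuousOn.congr ?_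
    intro t ht
    rcases eq_or_lt_of_le (show 0 ≤ t from ht) with h | h
    · rw [← h, rl_zero, gp_zero (by linarith)]
    · exact hJ t h
  · intro t ht
    refine ⟨_, (gp_hasDerivAt (α := α) (μ := 2 * (α - 1) + (2 - α)) hB ht).congr_of_eventuallyEq ?_, ?_⟩
    · filter_upwards [eventually_gt_nhds ht] with x hx using hJ x hx
    -- second derivative representation
    have ha' := ha.lin α (α - 1)
    have hc' := hc.lin α (2 * (α - 1))
    set q := gp α a (α - 1) with hq
    set q' := gp α (fun k => (α * k + (α - 1)) * a k) (α - 1 - 1) with hq'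
    have hd : ∀ τ, 0 < τ → HasDerivAt q (q' τ) τ := fun τ hτ => gp_hasDerivAt ha hτ
    have e1 : ∀ τ, 0 < τ → gp α (fun k => (α * k + 2 * (α - 1)) * cp a a k) (2 * (α - 1) - 1) τ =
        2 * q τ * q' τ := fun τ hτ => by
      have hA := gp_hasDerivAt (α := α) (μ := 2 * (α - 1)) hc hτ
      have hB : HasDerivAt (gp α (cp a a) (2 * (α - 1))) (2 * q τ * q' τ) τ := by
        refine (((hd τ hτ).pow 2).congr_of_eventuallyEq ?_).congr_deriv (by simp)
        filter_upwards [eventually_gt_nhds hτ] with x hx using (gp_sq ha hx).symm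
      exact hA.unique hB
    have e2 : riemannLiouville (2 - α) (fun τ => 2 * q τ * q' τ) t = _ :=
      (rl_congr ht.le (fun τ hτ => (e1 τ hτ).symm)).trans
        (rl_gp hc' hα (by linarith) hg ht)
    have e3 : riemannLiouville (2 - α) q' t = _ := rl_gp ha' hα (by linarith) hg ht
    have e4 : gp α (fun k => a k * (Real.Gamma (α * k + α) / Real.Gamma (α * k + 1))) 0 t =
        riemannLiouville (2 - α) q' t := by
      rw [e3]
      refine gp_congr (fun k => ?_) (by ring)
      have hk : 0 ≤ α * k := by positivity
      rw [show α * k + (α - 1 - 1 + 1) = α * k + (α - 1) by ring,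
        show α * k + (α - 1) + (2 - α) = α * k + 1 by ring,
        show α * k + α = α * k + (α - 1) + 1 by ring, Real.Gamma_add_one (by linarith)]
      ring
    have e5 : gp α (fun k : ℕ => (α * k + (2 * (α - 1) + (2 - α))) *
        (cp a a k * (Real.Gamma (α * k + (2 * (α - 1) + 1)) / Real.Gamma (α * k + (2 * (α - 1) + 1) + (2 - α)))))
          (2 * (α - 1) + (2 - α) - 1) t = riemannLiouville (2 - α) (fun τ => 2 * q τ * q' τ) t := by
      rw [e2]
      refine gp_congr (fun k => ?_) (by ring)
      have hk : 0 ≤ α * k := by positivity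
      have hp : 0 < α * k + 2 * (α - 1) := by linarith
      have hG := Real.Gamma_pos_of_pos (add_pos hp hg)
      rw [show α * k + (2 * (α - 1) + 1) + (2 - α) = (α * k + 2 * (α - 1) + (2 - α)) + 1 by ring,
        show α * k + (2 * (α - 1) + 1) = (α * k + 2 * (α - 1)) + 1 by ring,
        show α * k + (2 * (α - 1) - 1 + 1) = α * k + 2 * (α - 1) by ring,
        Real.Gamma_add_one (by linarith), Real.Gamma_add_one (by linarith)]
      have : α * k + 2 * (α - 1) + (2 - α) ≠ 0 := by linarith
      field_simp
      ring
    rw [e4, e5]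
    have hqc : Continuous q := gp_continuous ha hα (by linarith)
    have i1 : IntervalIntegrable (fun τ => (t - τ) ^ (2 - α - 1) * q' τ) volume 0 t :=
      gp_intble ha' hα (by linarith) hg ht
    have i2 : IntervalIntegrable (fun τ => (t - τ) ^ (2 - α - 1) * q' τ * q τ) volume 0 t :=
      i1.mul_continuousOn hqc.continuousOn
    have i3 : IntervalIntegrable (fun τ => (t - τ) ^ (2 - α - 1) * q' τ * q t) volume 0 t :=
      i1.mul_const _
    have hG := Real.Gamma_pos_of_pos hg
    have key := alikhanov (b := α - 1) (t := t) (q := q) (q' := q') (by linarith) (by linarith) ht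
      hqc.continuousOn hd (by
        refine (i3.sub i2).congr (fun τ _ => ?_)
        simp only [show -(α - 1) = 2 - α - 1 by ring]
        ring)
    have e6 : ∫ τ in (0:ℝ)..t, (t - τ) ^ (-(α - 1)) * (q' τ * (q t - q τ)) =
        (∫ τ in (0:ℝ)..t, (t - τ) ^ (2 - α - 1) * q' τ) * q t -
        ∫ τ in (0:ℝ)..t, (t - τ) ^ (2 - α - 1) * q' τ * q τ := by
      rw [← intervalIntegral.integral_mul_const, ← intervalIntegral.integral_sub i3 i2]
      refine intervalIntegral.integral_congr (fun τ _ => ?_)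
      simp only [show -(α - 1) = 2 - α - 1 by ring]
      ring
    have e7 : ∫ τ in (0:ℝ)..t, (t - τ) ^ (2 - α - 1) * (2 * q τ * q' τ) =
        2 * ∫ τ in (0:ℝ)..t, (t - τ) ^ (2 - α - 1) * q' τ * q τ := by
      rw [← intervalIntegral.integral_const_mul]
      refine intervalIntegral.integral_congr (fun τ _ => ?_)
      ring
    simp only [riemannLiouville, smul_eq_mul]
    rw [e7]
    rw [e6] at key
    have : 0 ≤ (Real.Gamma (2 - α))⁻¹ := by positivity
    nlinarith [mul_nonneg this key]


/-- Mittag-Leffler coefficients -/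
noncomputable def mc (α β c : ℝ) (k : ℕ) : ℝ := c ^ k * (1 / Real.Gamma (α * k + β))

theorem ML_eq (α β c x : ℝ) : ML α β (c * x) = PS (mc α β c) x := by
  unfold ML PS mc
  refine tsum_congr (fun k => ?_)
  rw [mul_pow]; ring

theorem mc_ent {α β : ℝ} (hα : 1 < α) (hβ : 1 ≤ β) (c : ℝ) : Ent (mc α β c) := by
  refine Ent.scale (a := fun k : ℕ => 1 / Real.Gamma (α * k + β)) ?_ c
  have h0 : Ent (fun k : ℕ => 1 / (k.factorial : ℝ)) := by
    intro R hR
    refine (Real.summable_pow_div_factorial R).congr (fun k => ?_)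
    rw [abs_of_nonneg (by positivity)]; ring
  have hβ0 := Real.Gamma_pos_of_pos (show 0 < β by linarith)
  refine h0.of_le (1 + 1 / Real.Gamma β) (fun k => ?_)
  have hk : 0 ≤ α * k := by positivity
  have hG := Real.Gamma_pos_of_pos (show 0 < α * k + β by linarith)
  rw [abs_of_nonneg (by positivity), abs_of_nonneg (by positivity)]
  rcases Nat.eq_zero_or_pos k with h | h
  · subst h; simp
  · have hk1 : (1 : ℝ) ≤ k := by exact_mod_cast h
    have h1 : (k.factorial : ℝ) ≤ Real.Gamma (α * k + β) := by
      rw [← Real.Gamma_nat_eq_factorial]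
      exact Real.Gamma_strictMonoOn_Ici.monotoneOn (by simp; linarith) (by simp; nlinarith)
        (by nlinarith)
    have h2 : (0:ℝ) < k.factorial := by positivity
    calc 1 / Real.Gamma (α * k + β) ≤ 1 / (k.factorial : ℝ) := one_div_le_one_div_of_le h2 h1
      _ ≤ _ := by
        have : 0 ≤ 1 / Real.Gamma β * (1 / (k.factorial : ℝ)) := by positivity
        linarith

theorem gp_shift {α μ t : ℝ} {a : ℕ → ℝ} (ha : Ent a) (h0 : a 0 = 0) (ht : 0 < t) :
    gp α a μ t = gp α (fun k => a (k + 1)) (μ + α) t := by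
  unfold gp PS
  rw [(ha.summable _).tsum_eq_zero_add, h0, zero_mul, zero_add, Real.rpow_add ht, mul_assoc]
  congr 1
  rw [← tsum_mul_left]
  exact tsum_congr fun k => by ring

theorem gp_zero_zero {α : ℝ} {a : ℕ → ℝ} (hα : α ≠ 0) : gp α a 0 0 = a 0 := by
  simp only [gp, Real.rpow_zero, one_mul, PS, Real.zero_rpow hα]
  rw [tsum_eq_single 0]
  · simp
  · intro k hk; simp [hk]

theorem gp_lin {α μ t p : ℝ} {a b c : ℕ → ℝ} (ha : Ent a) (hb : Ent b)
    (h : ∀ k, c k = -(a k + p * b k)) : gp α c μ t = -(gp α a μ t + p * gp α b μ t) := by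
  have : PS c (t ^ α) = -(PS a (t ^ α) + p * PS b (t ^ α)) := by
    unfold PS
    rw [← tsum_mul_left, ← (ha.summable _).tsum_add ((hb.summable _).mul_left p), ← tsum_neg]
    exact tsum_congr fun k => by rw [h]; ring
  unfold gp
  rw [this]; ring

theorem rl_nonneg {g T : ℝ} (hg : 0 < g) (hT : 0 ≤ T) {f : ℝ → ℝ} (hf : ∀ τ, 0 ≤ f τ) :
    0 ≤ riemannLiouville g f T := by
  unfold riemannLiouville
  have := Real.Gamma_pos_of_pos hg
  refine mul_nonneg (by positivity) (intervalIntegral.integral_nonneg hT (fun τ hτ => ?_))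
  have : 0 ≤ T - τ := by linarith [hτ.2]
  exact mul_nonneg (by positivity) (hf τ)

theorem rl_lower {α T : ℝ} (h1 : 1 < α) (h2 : α < 2) (hT : 0 < T) {f : ℝ → ℝ} (hc : Continuous f)
    (hf : ∀ τ, 0 ≤ f τ) :
    ∫ τ in (0:ℝ)..T, f τ ≤
      Real.Gamma (2 - α) * T ^ (α - 1) * riemannLiouville (2 - α) f T := by
  have hG := Real.Gamma_pos_of_pos (show 0 < 2 - α by linarith)
  unfold riemannLiouville
  rw [smul_eq_mul, mul_comm (Real.Gamma (2 - α)), mul_assoc, mul_inv_cancel_left₀ hG.ne',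
    ← intervalIntegral.integral_const_mul]
  have i1 : IntervalIntegrable (fun τ => (T - τ) ^ (2 - α - 1) * f τ) volume 0 T := by
    have := (beta_intble (s := 1) (g := 2 - α) one_pos (by linarith) hT).mul_continuousOn
      hc.continuousOn
    simpa using this
  refine intervalIntegral.integral_mono_on_of_le_Ioo hT.le (hc.intervalIntegrable _ _)
    (i1.const_mul _) (fun τ hτ => ?_)
  have h3 : 0 < T - τ := by linarith [hτ.2]
  have h4 : T ^ (2 - α - 1) ≤ (T - τ) ^ (2 - α - 1) :=
    Real.rpow_le_rpow_of_nonpos h3 (by linarith [hτ.1]) (by linarith)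
  have h5 : T ^ (α - 1) * T ^ (2 - α - 1) = 1 := by
    rw [← Real.rpow_add hT, show α - 1 + (2 - α - 1) = 0 by ring, Real.rpow_zero]
  have h6 : 1 ≤ T ^ (α - 1) * (T - τ) ^ (2 - α - 1) := by
    exact h5.symm.le.trans (mul_le_mul_of_nonneg_left h4 (by positivity))
  simp only [smul_eq_mul]
  rw [← mul_assoc]
  nlinarith [hf τ]

theorem antitone_end {F : ℝ → ℝ} {T : ℝ} (hT : 0 ≤ T) (hc : ContinuousOn F (Icc 0 T))
    (hd : ∀ t ∈ Ioo 0 T, ∃ d, HasDerivAt F d t ∧ d ≤ 0) : F T ≤ F 0 := by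
  refine antitoneOn_of_deriv_nonpos (convex_Icc 0 T) hc ?_ ?_ (left_mem_Icc.2 hT)
    (right_mem_Icc.2 hT) hT
  · rw [interior_Icc]
    intro t ht
    obtain ⟨d, h, -⟩ := hd t ht
    exact h.differentiableAt.differentiableWithinAt
  · rw [interior_Icc]
    intro t ht
    obtain ⟨d, h, h'⟩ := hd t ht
    rwa [h.deriv]

theorem Gamma_rec {α : ℝ} (hα : 1 < α) (k : ℕ) :
    Real.Gamma (α * ((k + 1 : ℕ) : ℝ) + 1) = α * (k + 1) * Real.Gamma (α * k + α) := by
  rw [Real.Gamma_add_one (by positivity)]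
  push_cast
  ring_nf

theorem main_bounds {α : ℝ} (h1 : 1 < α) (h2 : α < 2) {T : ℝ} (hT : 0 < T) :
    gp α (mc α 1 (-1)) 0 T ^ 2 ≤ 1 ∧
    (T * gp α (mc α α (-1)) (α - 1) T) ^ 2 ≤ 2 * α * Real.Gamma (2 - α) * T ^ α := by
  have hα : 0 ≤ α := by linarith
  have hg : 0 < 2 - α := by linarith
  have hG := Real.Gamma_pos_of_pos hg
  have E1 := mc_ent h1 le_rfl (-1)
  have Eα := mc_ent h1 h1.le (-1)
  set y := gp α (mc α 1 (-1)) 0 with hy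
  set g := gp α (mc α α (-1)) (α - 1) with hgdef
  have hgc : Continuous g := gp_continuous Eα hα (by linarith)
  have hyc : Continuous y := gp_continuous E1 hα le_rfl
  have hyd : ∀ t, 0 < t → HasDerivAt y (-g t) t := by
    intro t ht
    refine (gp_hasDerivAt E1 ht).congr_deriv ?_
    rw [gp_shift (E1.lin α 0) (by simp) ht]
    have := gp_lin (α := α) (μ := α - 1) (t := t) (p := 0) (c := fun k => -mc α α (-1) k) Eα Eα
      (fun k => by ring)
    rw [zero_mul, add_zero] at this
    rw [hgdef, ← this]
    refine gp_congr (fun k => ?_) (by ring)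
    simp only [mc]
    rw [Gamma_rec h1]
    have := Real.Gamma_pos_of_pos (show 0 < α * k + α by positivity)
    push_cast
    field_simp
    ring
  obtain ⟨hJc, hJd⟩ := energy h1 h2 Eα
  rw [← hgdef] at hJc hJd
  have hY : ∀ t, gp α (fun k => mc α α (-1) k * (Real.Gamma (α * k + α) / Real.Gamma (α * k + 1))) 0 t
      = y t := by
    intro t
    refine gp_congr (fun k => ?_) rfl
    simp only [mc]
    have := Real.Gamma_pos_of_pos (show 0 < α * k + α by positivity)
    field_simp
  have A : ∀ T, 0 < T → y T ^ 2 + riemannLiouville (2 - α) (fun τ => g τ ^ 2) T ≤ 1 := by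
    intro T hT
    have := antitone_end (F := fun t => y t ^ 2 + riemannLiouville (2 - α) (fun τ => g τ ^ 2) t)
      hT.le
      ((hyc.pow 2).continuousOn.add (hJc.mono Icc_subset_Ici_self)) (fun t ht => by
        obtain ⟨J', hJ', hle⟩ := hJd t ht.1
        refine ⟨_, ((hyd t ht.1).pow 2).add hJ', ?_⟩
        rw [hY] at hle
        simp
        linarith)
    refine this.trans ?_
    simp only [rl_zero, hy, gp_zero_zero (by linarith : α ≠ 0)]
    simp [mc]
  have hpos : ∀ T, 0 < T → 0 ≤ riemannLiouville (2 - α) (fun τ => g τ ^ 2) T := fun T hT =>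
    rl_nonneg hg hT.le (fun τ => sq_nonneg _)
  refine ⟨by linarith [A T hT, hpos T hT], ?_⟩
  have hI : ∫ τ in (0:ℝ)..T, g τ ^ 2 ≤ Real.Gamma (2 - α) * T ^ (α - 1) := by
    refine (rl_lower h1 h2 hT (hgc.pow 2) (fun τ => sq_nonneg _)).trans ?_
    have : riemannLiouville (2 - α) (fun τ => g τ ^ 2) T ≤ 1 := by
      linarith [A T hT, sq_nonneg (y T)]
    have h0 : 0 ≤ Real.Gamma (2 - α) * T ^ (α - 1) := by positivity
    exact (mul_le_mul_of_nonneg_left this h0).trans (by rw [mul_one])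
  -- second energy estimate
  have EZ := E1.lin α 0
  have Eq := Eα.lin α 0
  set Z := gp α (fun k => (α * k + 0) * mc α 1 (-1) k) 0 with hZ
  set q := gp α (fun k => (α * k + 0) * mc α α (-1) k) (α - 1) with hq
  have hZc : Continuous Z := gp_continuous EZ hα le_rfl
  have hZg : ∀ t, 0 < t → Z t = -(t * g t) := by
    intro t ht
    have h := (gp_hasDerivAt (α := α) (μ := 0) E1 ht).unique (hyd t ht)
    have h' : Z t = t * gp α (fun k => (α * k + 0) * mc α 1 (-1) k) (0 - 1) t := by
      simp only [hZ, gp]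
      rw [← mul_assoc, Real.rpow_sub_one ht.ne']
      field_simp
    rw [h', h]; ring
  have hZd : ∀ t, 0 < t → HasDerivAt Z (-(q t + α * g t)) t := by
    intro t ht
    refine (gp_hasDerivAt EZ ht).congr_deriv ?_
    rw [gp_shift (EZ.lin α 0) (by simp) ht]
    have := gp_lin (α := α) (μ := α - 1) (t := t) (p := α)
      (c := fun k => -((α * k + 0) * mc α α (-1) k + α * mc α α (-1) k)) Eq Eα (fun k => rfl)
    rw [hgdef, hq, ← this]
    refine gp_congr (fun k => ?_) (by ring)
    simp only [mc]
    rw [Gamma_rec h1]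
    have := Real.Gamma_pos_of_pos (show 0 < α * k + α by positivity)
    push_cast
    field_simp
    ring
  obtain ⟨hKc, hKd⟩ := energy h1 h2 Eq
  rw [← hq] at hKc hKd
  have hZY : ∀ t, gp α (fun k => (α * k + 0) * mc α α (-1) k *
      (Real.Gamma (α * k + α) / Real.Gamma (α * k + 1))) 0 t = Z t := by
    intro t
    refine gp_congr (fun k => ?_) rfl
    simp only [mc]
    have := Real.Gamma_pos_of_pos (show 0 < α * k + α by positivity)
    field_simp
  have hId : ∀ t, HasDerivAt (fun s => ∫ τ in (0:ℝ)..s, g τ ^ 2) (g t ^ 2) t := fun t =>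
    intervalIntegral.integral_hasDerivAt_right ((hgc.pow 2).intervalIntegrable _ _)
      ((hgc.pow 2).stronglyMeasurableAtFilter _ _) (hgc.pow 2).continuousAt
  have B := antitone_end (F := fun t => Z t ^ 2 + riemannLiouville (2 - α) (fun τ => q τ ^ 2) t
      - 2 * α * T * ∫ τ in (0:ℝ)..t, g τ ^ 2)
      hT.le
      (((hZc.pow 2).continuousOn.add (hKc.mono Icc_subset_Ici_self)).sub
        (continuousOn_const.mul (fun t _ => (hId t).continuousAt.continuousWithinAt))) (fun t ht => by
        obtain ⟨J', hJ', hle⟩ := hKd t ht.1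
        refine ⟨_, ((((hZd t ht.1).pow 2).add hJ').sub ((hId t).const_mul (2 * α * T))), ?_⟩
        rw [hZY] at hle
        have e := hZg t ht.1
        have : 2 * α * g t ^ 2 * t ≤ 2 * α * g t ^ 2 * T := by
          have := ht.2.le
          gcongr
        simp
        rw [e] at hle ⊢
        linarith)
  have hpos' := rl_nonneg hg hT.le (f := fun τ => q τ ^ 2) (fun τ => sq_nonneg _)
  have hZ0 : Z 0 = 0 := by
    rw [hZ, gp_zero_zero (by linarith : α ≠ 0)]; simp
  simp only [rl_zero, hZ0, intervalIntegral.integral_same] at B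
  rw [hZg T hT] at B
  have e8 : T ^ α = T * T ^ (α - 1) := by
    rw [Real.rpow_sub_one hT.ne']; field_simp
  rw [e8]
  have : 2 * α * T * ∫ τ in (0:ℝ)..T, g τ ^ 2 ≤ 2 * α * T * (Real.Gamma (2 - α) * T ^ (α - 1)) := by
    gcongr
  nlinarith

theorem ML_gp {α β μ c t : ℝ} : t ^ μ * ML α β (c * t ^ α) = gp α (mc α β c) μ t := by
  rw [ML_eq]; rfl

theorem ML_one_bound {α x : ℝ} (h1 : 1 < α) (h2 : α < 2) (hx : 0 ≤ x) : |ML α 1 (-x)| ≤ 1 := by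
  rcases eq_or_lt_of_le hx with h | h
  · subst h
    have := ML_eq α 1 (-1) 0
    have h3 := gp_zero_zero (α := α) (a := mc α 1 (-1)) (by linarith)
    simp [gp, Real.zero_rpow (show α ≠ 0 by linarith)] at h3
    simp [h3] at this
    simp [this, mc]
  · have hT : 0 < x ^ α⁻¹ := by positivity
    have := (main_bounds h1 h2 hT).1
    rw [← ML_gp, Real.rpow_inv_rpow hx (by linarith)] at this
    simp at this
    simpa using this

theorem ML_alpha_bound {α x : ℝ} (h1 : 1 < α) (h2 : α < 2) (hx : 0 < x) :
    x * ML α α (-x) ^ 2 ≤ 2 * α * Real.Gamma (2 - α) := by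
  have hT : 0 < x ^ α⁻¹ := by positivity
  have := (main_bounds h1 h2 hT).2
  rw [← ML_gp, Real.rpow_inv_rpow hx.le (by linarith), ← mul_assoc, Real.rpow_sub_one hT.ne',
    mul_div_cancel₀ _ hT.ne', Real.rpow_inv_rpow hx.le (by linarith)] at this
  simp only [neg_mul, one_mul] at this
  refine le_of_mul_le_mul_right ?_ hx
  linarith


theorem rl_mc {α β μ g c t : ℝ} (h1 : 1 < α) (hβ : 1 ≤ β) (hμβ : μ = β - 1) (hg : 0 < g)
    (ht : 0 ≤ t) :
    riemannLiouville g (gp α (mc α β c) μ) t = gp α (mc α (β + g) c) (μ + g) t := by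
  rcases eq_or_lt_of_le ht with h | h
  · rw [← h, rl_zero, gp_zero (by linarith)]
  rw [rl_gp (mc_ent h1 hβ c) (by linarith) (by linarith) hg h]
  refine gp_congr (fun k => ?_) rfl
  simp only [mc]
  have hk : 0 < α * k + β := by
    have : 0 ≤ α * k := by positivity
    linarith
  have h3 := Real.Gamma_pos_of_pos hk
  rw [hμβ, sub_add_cancel, add_assoc]
  field_simp

theorem rl_one {f : ℝ → ℝ} {t : ℝ} : riemannLiouville 1 f t = ∫ τ in (0:ℝ)..t, f τ := by
  simp [riemannLiouville]

theorem gp_one_sub {α c τ : ℝ} (h1 : 1 < α) (hτ : 0 < τ) :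
    gp α (mc α 1 c) 0 τ - 1 = c * gp α (mc α (α + 1) c) α τ := by
  unfold gp PS
  rw [((mc_ent h1 le_rfl c).summable _).tsum_eq_zero_add, Real.rpow_zero, one_mul, ← mul_assoc,
    ← tsum_mul_left]
  simp only [mc]
  simp
  refine tsum_congr (fun k => ?_)
  rw [show α * ((k:ℝ) + 1) + 1 = α * k + (α + 1) by ring]
  ring

theorem coef_identity {α l t a0 a1 : ℝ} (h1 : 1 < α) (h2 : α < 2) (ht : 0 ≤ t) :
    riemannLiouville (2 - α) (fun τ => (-(l * a0 * (τ ^ (α - 1) * ML α α (-(l * τ ^ α)))) +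
        a1 * ML α 1 (-(l * τ ^ α))) - a1) t =
      -(l * ∫ τ in (0:ℝ)..t, (a0 * ML α 1 (-(l * τ ^ α)) + a1 * (τ * ML α 2 (-(l * τ ^ α))))) := by
  have hα : 0 ≤ α := by linarith
  have hg : 0 < 2 - α := by linarith
  rcases eq_or_lt_of_le ht with h | htp
  · subst h; simp [rl_zero]
  have m0 : ∀ τ, ML α 1 (-(l * τ ^ α)) = gp α (mc α 1 (-l)) 0 τ := fun τ => by
    rw [← ML_gp]; simp
  have m1 : ∀ τ, τ * ML α 2 (-(l * τ ^ α)) = gp α (mc α 2 (-l)) 1 τ := fun τ => by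
    rw [← ML_gp]; simp
  have m2 : ∀ τ, τ ^ (α - 1) * ML α α (-(l * τ ^ α)) = gp α (mc α α (-l)) (α - 1) τ := fun τ => by
    rw [← ML_gp]; simp
  simp only [m0, m1, m2]
  have c0 : Continuous (gp α (mc α 1 (-l)) 0) := gp_continuous (mc_ent h1 le_rfl _) hα le_rfl
  have c1 : Continuous (gp α (mc α 2 (-l)) 1) :=
    gp_continuous (mc_ent h1 (by norm_num) _) hα zero_le_one
  have r0 : ∫ τ in (0:ℝ)..t, gp α (mc α 1 (-l)) 0 τ = gp α (mc α 2 (-l)) 1 t := by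
    rw [← rl_one, rl_mc h1 le_rfl (by norm_num) one_pos ht]
    norm_num
  have r1 : ∫ τ in (0:ℝ)..t, gp α (mc α 2 (-l)) 1 τ = gp α (mc α 3 (-l)) 2 t := by
    rw [← rl_one, rl_mc h1 (by norm_num) (by norm_num) one_pos ht]
    norm_num
  rw [intervalIntegral.integral_add ((c0.intervalIntegrable _ _).const_mul _)
    ((c1.intervalIntegrable _ _).const_mul _), intervalIntegral.integral_const_mul,
    intervalIntegral.integral_const_mul, r0, r1]
  have r2 : riemannLiouville (2 - α) (gp α (mc α α (-l)) (α - 1)) t = gp α (mc α 2 (-l)) 1 t := by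
    rw [rl_mc h1 h1.le rfl hg ht]
    exact gp_congr (fun k => by rw [add_sub_cancel]) (by ring)
  have r3 : riemannLiouville (2 - α) (gp α (mc α (α + 1) (-l)) α) t = gp α (mc α 3 (-l)) 2 t := by
    rw [rl_mc h1 (by linarith) (by ring) hg ht]
    exact gp_congr (fun k => by rw [show α + 1 + (2 - α) = 3 by ring]) (by ring)
  have i2 := gp_intble (μ := α - 1) (mc_ent h1 h1.le (-l)) hα (by linarith) hg htp
  have i3 := gp_intble (μ := α) (mc_ent h1 (show 1 ≤ α + 1 by linarith) (-l)) hα (by linarith) hg htp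
  rw [rl_congr ht (h := fun τ => -(l * a0) * gp α (mc α α (-l)) (α - 1) τ +
    (a1 * -l) * gp α (mc α (α + 1) (-l)) α τ) (fun τ hτ => by
      have := gp_one_sub (α := α) (c := -l) h1 hτ
      linear_combination a1 * this)]
  have : riemannLiouville (2 - α) (fun τ => -(l * a0) * gp α (mc α α (-l)) (α - 1) τ +
    (a1 * -l) * gp α (mc α (α + 1) (-l)) α τ) t = -(l * a0) *
      riemannLiouville (2 - α) (gp α (mc α α (-l)) (α - 1)) t + (a1 * -l) *
      riemannLiouville (2 - α) (gp α (mc α (α + 1) (-l)) α) t := by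
    simp only [riemannLiouville, smul_eq_mul]
    rw [mul_left_comm, mul_left_comm (a1 * -l), ← mul_add]
    congr 1
    rw [← intervalIntegral.integral_const_mul, ← intervalIntegral.integral_const_mul,
      ← intervalIntegral.integral_add (i2.const_mul _) (i3.const_mul _)]
    refine intervalIntegral.integral_congr (fun τ _ => ?_)
    ring
  rw [this, r2, r3]
  ring

theorem ML_bounds {α : ℝ} (h1 : 1 < α) (h2 : α < 2) : ∃ D, 0 ≤ D ∧
    (∀ x, 0 ≤ x → √x * |ML α α (-x)| ≤ D) ∧ (∀ x, 0 ≤ x → √x * |ML α 2 (-x)| ≤ D) := by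
  have hα : 0 ≤ α := by linarith
  have hg : 0 < 2 - α := by linarith
  have hG := Real.Gamma_pos_of_pos hg
  set D := √(2 * α * Real.Gamma (2 - α)) with hD
  have hA : ∀ x, 0 ≤ x → √x * |ML α α (-x)| ≤ D := by
    intro x hx
    rcases eq_or_lt_of_le hx with h | h
    · rw [← h]; simp [hD]
    · rw [← Real.sqrt_sq_eq_abs, ← Real.sqrt_mul hx]
      exact Real.sqrt_le_sqrt (ML_alpha_bound h1 h2 h)
  set K := (Real.Gamma (2 - α))⁻¹ * (Real.Gamma (α / 2) * Real.Gamma (2 - α) /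
    Real.Gamma (α / 2 + (2 - α))) with hK
  have hK0 : 0 ≤ K := by
    have := Real.Gamma_pos_of_pos (show 0 < α / 2 by linarith)
    have := Real.Gamma_pos_of_pos (show 0 < α / 2 + (2 - α) by linarith)
    positivity
  have hD0 : 0 ≤ D := Real.sqrt_nonneg _
  refine ⟨max D (D * K), le_max_of_le_left hD0, fun x hx => (hA x hx).trans (le_max_left _ _),
    fun x hx => ?_⟩
  rcases eq_or_lt_of_le hx with h | h
  · rw [← h]; simp [hD0]
  refine le_trans ?_ (le_max_right _ _)
  obtain ⟨t, ht, rfl⟩ : ∃ t : ℝ, 0 < t ∧ t ^ α = x :=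
    ⟨x ^ α⁻¹, by positivity, Real.rpow_inv_rpow hx (by linarith)⟩
  have hsq : ∀ t : ℝ, 0 < t → √(t ^ α) = t ^ (α / 2) := fun t ht => by
    rw [Real.sqrt_eq_rpow, ← Real.rpow_mul ht.le]; congr 1; ring
  have r2 : riemannLiouville (2 - α) (gp α (mc α α (-1)) (α - 1)) t = gp α (mc α 2 (-1)) 1 t := by
    rw [rl_mc h1 h1.le rfl hg ht.le]
    exact gp_congr (fun k => by rw [add_sub_cancel]) (by ring)
  have hb : ∀ τ, 0 < τ → |gp α (mc α α (-1)) (α - 1) τ| ≤ D * τ ^ (α / 2 - 1) := by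
    intro τ hτ
    rw [← ML_gp]
    have := hA (τ ^ α) (by positivity)
    rw [hsq τ hτ] at this
    rw [abs_mul, abs_of_pos (by positivity : 0 < τ ^ (α - 1)), neg_one_mul]
    calc τ ^ (α - 1) * |ML α α (-τ ^ α)| = τ ^ (α / 2 - 1) * (τ ^ (α / 2) * |ML α α (-τ ^ α)|) := by
          rw [← mul_assoc, ← Real.rpow_add hτ]; congr 2; ring
      _ ≤ τ ^ (α / 2 - 1) * D := by gcongr
      _ = _ := mul_comm _ _
  have hi := beta_intble (s := α / 2) (g := 2 - α) (by linarith) hg ht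
  have hi2 := gp_intble (μ := α - 1) (mc_ent h1 h1.le (-1)) hα (by linarith) hg ht
  have h3 : |gp α (mc α 2 (-1)) 1 t| ≤ D * K * t ^ (1 - α / 2) := by
    rw [← r2]
    unfold riemannLiouville
    rw [smul_eq_mul, abs_mul, abs_of_pos (inv_pos.2 hG)]
    have : |∫ τ in (0:ℝ)..t, (t - τ) ^ (2 - α - 1) • gp α (mc α α (-1)) (α - 1) τ| ≤
        ∫ τ in (0:ℝ)..t, D * ((t - τ) ^ (2 - α - 1) * τ ^ (α / 2 - 1)) := by
      refine (intervalIntegral.abs_integral_le_integral_abs ht.le).trans ?_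
      refine intervalIntegral.integral_mono_on_of_le_Ioo ht.le hi2.abs (hi.const_mul D) ?_
      intro τ hτ
      have h0 : 0 < t - τ := by linarith [hτ.2]
      rw [smul_eq_mul, abs_mul, abs_of_pos (by positivity)]
      have := mul_le_mul_of_nonneg_left (hb τ hτ.1) (by positivity : 0 ≤ (t - τ) ^ (2 - α - 1))
      linarith
    rw [intervalIntegral.integral_const_mul, beta_int (by linarith) hg ht] at this
    refine (mul_le_mul_of_nonneg_left this (inv_pos.2 hG).le).trans (le_of_eq ?_)
    rw [hK, show α / 2 + (2 - α) - 1 = 1 - α / 2 by ring]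
    ring
  rw [hsq t ht]
  rw [← ML_gp, Real.rpow_one, abs_mul, abs_of_pos ht, neg_one_mul] at h3
  have h4 : t ^ (1 - α / 2) = t * (t ^ (α / 2))⁻¹ := by
    rw [sub_eq_add_neg, Real.rpow_add ht, Real.rpow_neg ht.le, Real.rpow_one]
  have h5 : 0 < t ^ (α / 2) := by positivity
  rw [h4] at h3
  have h6 : |ML α 2 (-t ^ α)| ≤ D * K * (t ^ (α / 2))⁻¹ := by
    refine le_of_mul_le_mul_left ?_ ht
    linarith
  calc _ ≤ t ^ (α / 2) * (D * K * (t ^ (α / 2))⁻¹) := by gcongr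
    _ = D * K := by field_simp

theorem sq_summable_mul {a b : ℕ → ℝ} (ha : Summable fun n => a n ^ 2)
    (hb : Summable fun n => b n ^ 2) : Summable fun n => |a n| * |b n| := by
  refine Summable.of_nonneg_of_le (fun n => by positivity) (fun n => ?_) (ha.add hb)
  nlinarith [sq_nonneg (|a n| - |b n|), sq_abs (a n), sq_abs (b n), sq_nonneg (a n), sq_nonneg (b n)]

theorem basis_sum {H : Type*} [NormedAddCommGroup H] [InnerProductSpace ℝ H] [CompleteSpace H]
    (e : HilbertBasis ℕ ℝ H) {a : ℕ → ℝ} (ha : Summable fun n => a n ^ 2) :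
    ∃ x : H, HasSum (fun n => a n • e n) x ∧ ‖x‖ ^ 2 = ∑' n, a n ^ 2 := by
  have hm : Memℓp a 2 := by
    rw [memℓp_gen_iff (by norm_num)]
    simpa using ha
  let f : lp (fun _ : ℕ => ℝ) 2 := ⟨a, hm⟩
  refine ⟨e.repr.symm f, e.hasSum_repr_symm f, ?_⟩
  rw [LinearIsometryEquiv.norm_map]
  have := lp.norm_rpow_eq_tsum (p := 2) (by norm_num) f
  simpa [f] using this

theorem inner_sq_summable {H : Type*} [NormedAddCommGroup H] [InnerProductSpace ℝ H]
    (e : HilbertBasis ℕ ℝ H) (x : H) : Summable fun n => ⟪x, e n⟫ ^ 2 := by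
  have := e.orthonormal.inner_products_summable x
  refine this.congr (fun n => ?_)
  rw [real_inner_comm, Real.norm_eq_abs, sq_abs]


theorem d_bound {α l a0 a1 D τ : ℝ} (h1 : 1 < α) (h2 : α < 2) (hl : 0 < l)
    (hD : ∀ x, 0 ≤ x → √x * |ML α α (-x)| ≤ D) (hτ : 0 < τ) :
    |-(l * a0 * (τ ^ (α - 1) * ML α α (-(l * τ ^ α)))) + a1 * ML α 1 (-(l * τ ^ α))| ≤
      D * (√l * |a0|) * τ ^ (α / 2 - 1) + |a1| := by
  have hx : 0 ≤ l * τ ^ α := by positivity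
  have hsq : √(τ ^ α) = τ ^ (α / 2) := by
    rw [Real.sqrt_eq_rpow, ← Real.rpow_mul hτ.le]; congr 1; ring
  have hA := hD _ hx
  have hB := ML_one_bound h1 h2 hx
  rw [Real.sqrt_mul hl.le, hsq] at hA
  refine (abs_add_le _ _).trans (add_le_add ?_ ?_)
  · rw [abs_neg, abs_mul, abs_mul, abs_mul, abs_of_pos hl, abs_of_pos (by positivity : 0 < τ ^ (α - 1))]
    have e1 : τ ^ (α - 1) = τ ^ (α / 2 - 1) * τ ^ (α / 2) := by
      rw [← Real.rpow_add hτ]; congr 1; ring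
    have e2 := Real.mul_self_sqrt hl.le
    calc _ = √l * |a0| * τ ^ (α / 2 - 1) * (√l * τ ^ (α / 2) * |ML α α (-(l * τ ^ α))|) := by
          rw [e1]; nth_rewrite 1 [← e2]; ring
      _ ≤ √l * |a0| * τ ^ (α / 2 - 1) * D := by gcongr
      _ = _ := by ring
  · rw [abs_mul]
    exact mul_le_of_le_one_right (abs_nonneg _) hB

theorem c_bound {α l a0 a1 D τ T : ℝ} (h1 : 1 < α) (h2 : α < 2) (hl : 0 < l) (hD0 : 0 ≤ D)
    (hD : ∀ x, 0 ≤ x → √x * |ML α 2 (-x)| ≤ D) (hτ : 0 ≤ τ) (hT : τ ≤ T) :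
    √l * |a0 * ML α 1 (-(l * τ ^ α)) + a1 * (τ * ML α 2 (-(l * τ ^ α)))| ≤
      √l * |a0| + D * T ^ (1 - α / 2) * |a1| := by
  have hx : 0 ≤ l * τ ^ α := by positivity
  have hB := ML_one_bound h1 h2 hx
  have hA := hD _ hx
  refine (mul_le_mul_of_nonneg_left (abs_add_le _ _) (Real.sqrt_nonneg _)).trans ?_
  rw [mul_add]
  refine add_le_add ?_ ?_
  · rw [abs_mul]
    exact mul_le_mul_of_nonneg_left (mul_le_of_le_one_right (abs_nonneg _) hB) (Real.sqrt_nonneg _)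
  rcases eq_or_lt_of_le hτ with h | hτ'
  · subst h; simp; positivity
  have hsq : √(τ ^ α) = τ ^ (α / 2) := by
    rw [Real.sqrt_eq_rpow, ← Real.rpow_mul hτ]; congr 1; ring
  rw [Real.sqrt_mul hl.le, hsq] at hA
  have e1 : τ = τ ^ (1 - α / 2) * τ ^ (α / 2) := by
    rw [← Real.rpow_add hτ']; simp
  have e3 : τ ^ (1 - α / 2) ≤ T ^ (1 - α / 2) := Real.rpow_le_rpow hτ hT (by linarith)
  have hT0 : 0 ≤ T ^ (1 - α / 2) := Real.rpow_nonneg (hτ.trans hT) _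
  rw [abs_mul, abs_mul, abs_of_pos hτ']
  calc _ = |a1| * τ ^ (1 - α / 2) * (√l * τ ^ (α / 2) * |ML α 2 (-(l * τ ^ α))|) := by
        nth_rewrite 1 [e1]; ring
    _ ≤ |a1| * T ^ (1 - α / 2) * D := by gcongr
    _ = _ := by ring

theorem c_cont {α l a0 a1 : ℝ} (h1 : 1 < α) :
    Continuous fun τ : ℝ => a0 * ML α 1 (-(l * τ ^ α)) + a1 * (τ * ML α 2 (-(l * τ ^ α))) := by
  have m0 : ∀ τ : ℝ, ML α 1 (-(l * τ ^ α)) = gp α (mc α 1 (-l)) 0 τ := fun τ => by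
    rw [← ML_gp]; simp
  have m1 : ∀ τ : ℝ, τ * ML α 2 (-(l * τ ^ α)) = gp α (mc α 2 (-l)) 1 τ := fun τ => by
    rw [← ML_gp]; simp
  simp only [m0, m1]
  have c0 : Continuous (gp α (mc α 1 (-l)) 0) := gp_continuous (mc_ent h1 le_rfl _) (by linarith) le_rfl
  have c1 : Continuous (gp α (mc α 2 (-l)) 1) :=
    gp_continuous (mc_ent h1 (by norm_num) _) (by linarith) zero_le_one
  fun_prop

theorem d_cont {α l a0 a1 : ℝ} (h1 : 1 < α) :
    Continuous fun τ : ℝ => -(l * a0 * (τ ^ (α - 1) * ML α α (-(l * τ ^ α)))) +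
        a1 * ML α 1 (-(l * τ ^ α)) := by
  have m0 : ∀ τ : ℝ, ML α 1 (-(l * τ ^ α)) = gp α (mc α 1 (-l)) 0 τ := fun τ => by
    rw [← ML_gp]; simp
  have m2 : ∀ τ : ℝ, τ ^ (α - 1) * ML α α (-(l * τ ^ α)) = gp α (mc α α (-l)) (α - 1) τ := fun τ => by
    rw [← ML_gp]; simp
  simp only [m0, m2]
  have c0 : Continuous (gp α (mc α 1 (-l)) 0) := gp_continuous (mc_ent h1 le_rfl _) (by linarith) le_rfl
  have c1 : Continuous (gp α (mc α α (-l)) (α - 1)) :=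
    gp_continuous (mc_ent h1 h1.le _) (by linarith) (by linarith)
  fun_prop

theorem weak_int {H : Type*} [NormedAddCommGroup H] [InnerProductSpace ℝ H] [CompleteSpace H]
    (e : HilbertBasis ℕ ℝ H) {d : ℕ → ℝ → ℝ} {q : ℕ → ℝ} {g ρ s : ℝ} (u v : H)
    (hg : 0 < g) (hρ : 0 < ρ) (hs : 0 < s) (hd : ∀ n, Continuous (d n))
    (hq0 : ∀ n, 0 ≤ q n) (hq : Summable fun n => q n ^ 2)
    (hb : ∀ n τ, 0 < τ → |d n τ| ≤ q n * τ ^ (ρ - 1) + |⟪u, e n⟫|) :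
    ⟪riemannLiouville g (fun τ => (∑' n, d n τ • e n) - u) s, v⟫ =
      ∑' n, riemannLiouville g (fun τ => d n τ - ⟪u, e n⟫) s * ⟪v, e n⟫ := by
  set r : ℕ → ℝ := fun n => ⟪u, e n⟫ with hr
  have hr2 : Summable fun n => r n ^ 2 := inner_sq_summable e u
  have hw2 : Summable fun n => ⟪v, e n⟫ ^ 2 := inner_sq_summable e v
  set Q := ∑' n, q n ^ 2
  set R := ∑' n, r n ^ 2
  have hQ : 0 ≤ Q := tsum_nonneg fun n => sq_nonneg _
  have hR : 0 ≤ R := tsum_nonneg fun n => sq_nonneg _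
  have hu : HasSum (fun n => r n • e n) u := by
    have := e.hasSum_repr u
    simpa only [HilbertBasis.repr_apply_apply, real_inner_comm, hr] using this
  have hle : ∀ n τ, 0 < τ → d n τ ^ 2 ≤ 2 * (τ ^ (ρ - 1)) ^ 2 * q n ^ 2 + 2 * r n ^ 2 := by
    intro n τ hτ
    have := hb n τ hτ
    have h2 : d n τ ^ 2 ≤ (q n * τ ^ (ρ - 1) + |r n|) ^ 2 := by
      rw [← sq_abs (d n τ)]
      gcongr
    nlinarith [sq_nonneg (q n * τ ^ (ρ - 1) - |r n|), sq_abs (r n)]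
  have hds : ∀ τ, 0 < τ → Summable fun n => d n τ ^ 2 := fun τ hτ =>
    Summable.of_nonneg_of_le (fun n => sq_nonneg _) (fun n => hle n τ hτ)
      ((hq.mul_left _).add (hr2.mul_left _))
  have hx : ∀ τ, 0 < τ → HasSum (fun n => d n τ • e n) (∑' n, d n τ • e n) ∧
      ‖∑' n, d n τ • e n‖ ≤ √(2 * Q) * τ ^ (ρ - 1) + √(2 * R) := by
    intro τ hτ
    obtain ⟨x, h1, h2⟩ := basis_sum e (hds τ hτ)
    rw [h1.tsum_eq]
    refine ⟨h1, ?_⟩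
    have h3 : ‖x‖ ^ 2 ≤ 2 * (τ ^ (ρ - 1)) ^ 2 * Q + 2 * R := by
      rw [h2, ← tsum_mul_left, ← tsum_mul_left, ← ((hq.mul_left _).tsum_add (hr2.mul_left _))]
      exact (hds τ hτ).tsum_le_tsum (fun n => hle n τ hτ) ((hq.mul_left _).add (hr2.mul_left _))
    have hp : 0 < τ ^ (ρ - 1) := by positivity
    refine abs_le_of_sq_le_sq' ?_ (by positivity) |>.2
    have e1 := Real.sq_sqrt (show 0 ≤ 2 * Q by positivity)
    have e2 := Real.sq_sqrt (show 0 ≤ 2 * R by positivity)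
    have : 0 ≤ √(2 * Q) * τ ^ (ρ - 1) * √(2 * R) := by positivity
    calc _ ≤ _ := h3
      _ = √(2 * Q) ^ 2 * (τ ^ (ρ - 1)) ^ 2 + √(2 * R) ^ 2 := by rw [e1, e2]; ring
      _ ≤ _ := by nlinarith
  set k : ℝ → ℝ := fun τ => (s - τ) ^ (g - 1) with hk
  have b1 : IntervalIntegrable (fun τ => k τ * τ ^ (ρ - 1)) volume 0 s := beta_intble hρ hg hs
  have b2 : IntervalIntegrable k volume 0 s := by
    have := beta_intble (s := 1) one_pos hg hs
    simpa using this
  rw [intervalIntegrable_iff_integrableOn_Ioc_of_le hs.le] at b1 b2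
  have hkm : Measurable k := by fun_prop
  have hk0 : ∀ τ ∈ Ioc 0 s, 0 ≤ k τ := fun τ hτ => Real.rpow_nonneg (by linarith [hτ.2]) _
  have hfm : AEStronglyMeasurable (fun τ => (∑' n, d n τ • e n) - u) (volume.restrict (Ioc 0 s)) := by
    refine AEStronglyMeasurable.sub ?_ aestronglyMeasurable_const
    refine aestronglyMeasurable_of_tendsto_ae atTop
      (f := fun N τ => ∑ n ∈ Finset.range N, d n τ • e n) (fun N => ?_) ?_
    · exact (continuous_finsetSum _ fun n _ => (hd n).smul continuous_const).aestronglyMeasurable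
    · filter_upwards [ae_restrict_mem measurableSet_Ioc] with τ hτ
      exact (hx τ hτ.1).1.tendsto_sum_nat
  have hint : Integrable (fun τ => k τ • ((∑' n, d n τ • e n) - u)) (volume.restrict (Ioc 0 s)) := by
    refine Integrable.mono' ((b1.const_mul (√(2 * Q))).add (b2.const_mul (√(2 * R) + ‖u‖)))
      (hkm.aestronglyMeasurable.smul hfm) ?_
    filter_upwards [ae_restrict_mem measurableSet_Ioc] with τ hτ
    rw [norm_smul, Real.norm_eq_abs, abs_of_nonneg (hk0 τ hτ)]
    have h1 := (norm_sub_le (∑' n, d n τ • e n) u).trans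
      (add_le_add_left (hx τ hτ.1).2 _)
    have := mul_le_mul_of_nonneg_left h1 (hk0 τ hτ)
    simp only [Pi.add_apply]
    linarith
  set F : ℕ → ℝ → ℝ := fun n τ => k τ * ((d n τ - r n) * ⟪v, e n⟫) with hF
  set B : ℕ → ℝ → ℝ := fun n τ => (q n * |⟪v, e n⟫|) * (k τ * τ ^ (ρ - 1)) +
    (2 * (|r n| * |⟪v, e n⟫|)) * k τ with hBdef
  have hBi : ∀ n, Integrable (B n) (volume.restrict (Ioc 0 s)) := fun n =>
    (b1.const_mul _).add (b2.const_mul _)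
  have hFB : ∀ n, ∀ τ ∈ Ioc 0 s, ‖F n τ‖ ≤ B n τ := by
    intro n τ hτ
    have h0 := hk0 τ hτ
    rw [hF, hBdef]
    simp only [norm_mul, Real.norm_eq_abs]
    rw [abs_of_nonneg h0]
    have h1 : |d n τ - r n| ≤ q n * τ ^ (ρ - 1) + 2 * |r n| := by
      have := (abs_sub (d n τ) (r n))
      have := hb n τ hτ.1
      linarith
    calc _ ≤ k τ * ((q n * τ ^ (ρ - 1) + 2 * |r n|) * |⟪v, e n⟫|) := by gcongr
      _ = _ := by ring
  have hFi : ∀ n, Integrable (F n) (volume.restrict (Ioc 0 s)) := by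
    intro n
    refine Integrable.mono' (hBi n) ?_ ?_
    · have := (hd n).measurable
      exact Measurable.aestronglyMeasurable (by fun_prop)
    · filter_upwards [ae_restrict_mem measurableSet_Ioc] with τ hτ using hFB n τ hτ
  have hFs : Summable fun n => ∫ τ in Ioc 0 s, ‖F n τ‖ := by
    refine Summable.of_nonneg_of_le (fun n => integral_nonneg fun _ => norm_nonneg _)
      (f := fun n => (q n * |⟪v, e n⟫|) * (∫ τ in Ioc 0 s, k τ * τ ^ (ρ - 1)) +
        (2 * (|r n| * |⟪v, e n⟫|)) * ∫ τ in Ioc 0 s, k τ) (fun n => ?_) ?_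
    · rw [← integral_const_mul, ← integral_const_mul,
        ← integral_add (b1.const_mul _) (b2.const_mul _)]
      exact setIntegral_mono_on (hFi n).norm (hBi n) measurableSet_Ioc (hFB n)
    · refine Summable.add (Summable.mul_right _ ?_) (Summable.mul_right _ (Summable.mul_left _ ?_))
      · have := sq_summable_mul hq hw2
        simpa only [abs_of_nonneg (hq0 _)] using this
      · exact sq_summable_mul hr2 hw2
  have hmain := hasSum_integral_of_summable_integral_norm hFi hFs
  have hsum : ∀ τ ∈ Ioc 0 s, ∑' n, F n τ = ⟪v, k τ • ((∑' n, d n τ • e n) - u)⟫ := by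
    intro τ hτ
    have h1 := ((hx τ hτ.1).1.sub hu).const_smul (k τ)
    have h2 := (innerSL ℝ v).hasSum h1
    rw [innerSL_apply_apply] at h2
    rw [← h2.tsum_eq]
    refine tsum_congr fun n => ?_
    simp only [Function.comp, innerSL_apply_apply, ← sub_smul, inner_smul_right, hF]
  unfold riemannLiouville
  rw [intervalIntegral.integral_of_le hs.le, real_inner_smul_left, real_inner_comm,
    ← integral_inner hint, ← setIntegral_congr_fun measurableSet_Ioc hsum, ← hmain.tsum_eq,
    ← tsum_mul_left]
  refine tsum_congr fun n => ?_
  rw [intervalIntegral.integral_of_le hs.le, smul_eq_mul, mul_assoc, ← integral_mul_const]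
  congr 1
  refine integral_congr_ae (ae_of_all _ fun τ => ?_)
  simp only [hF, hk, smul_eq_mul]
  ring

theorem int_tsum {c : ℕ → ℝ → ℝ} {b : ℕ → ℝ} {s T : ℝ} (hs : 0 ≤ s) (hsT : s ≤ T)
    (hc : ∀ n, Continuous (c n)) (hb : Summable b) (hcb : ∀ n, ∀ t ∈ Icc 0 T, |c n t| ≤ b n) :
    ∑' n, ∫ τ in (0:ℝ)..s, c n τ = ∫ τ in (0:ℝ)..s, ∑' n, c n τ := by
  simp only [intervalIntegral.integral_of_le hs]
  have hi : ∀ n, Integrable (c n) (volume.restrict (Ioc 0 s)) := fun n =>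
    ((hc n).integrableOn_Icc.mono_set Ioc_subset_Icc_self)
  refine (hasSum_integral_of_summable_integral_norm hi ?_).tsum_eq
  refine Summable.of_nonneg_of_le (fun n => integral_nonneg fun _ => norm_nonneg _)
      (f := fun n => b n * s) (fun n => ?_) (hb.mul_right _)
  have : ∫ τ in Ioc 0 s, b n = b n * s := by
    simp [hs, mul_comm]
  rw [← this]
  exact setIntegral_mono_on (hi n).norm (integrable_const _) measurableSet_Ioc
    (fun t ht => hcb n t ⟨ht.1.le, ht.2.trans hsT⟩)


end Helpers

/-- Let `α ∈ (1,2)`, `T > 0`, `u₀ ∈ D(√A)`, `u₁ ∈ H`, let `u` and `u'` be the series solution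
and its derivative. Then for every `v ∈ D(√A)` the map `t ↦ ⟨I^{2−α}(u'−u₁)(t), v⟩` is `C¹`
on `[0,T]` with `d/dt ⟨I^{2−α}(u'−u₁)(t), v⟩ + ⟨√A u(t), √A v⟩ = 0` for all `t ∈ [0,T]`
(note `⟨√A u(t), √A v⟩ = ∑ₙ λₙ ⟨u(t),eₙ⟩⟨v,eₙ⟩`, so the derivative equals
`−∑ₙ λₙ cₙ(t) ⟨v,eₙ⟩` and is continuous). -/
theorem weak_form_identity {H : Type*} [NormedAddCommGroup H]
    [InnerProductSpace ℝ H] [CompleteSpace H]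
    (e : HilbertBasis ℕ ℝ H) (lam : ℕ → ℝ) (hlam : ∀ n, 0 < lam n)
    (hlamT : Filter.Tendsto lam Filter.atTop Filter.atTop)
    (α T : ℝ) (hα1 : 1 < α) (hα2 : α < 2) (hT : 0 < T)
    (u₀ u₁ : H) (hu₀ : Summable fun n => lam n * ⟪u₀, e n⟫ ^ 2) :
    let c : ℕ → ℝ → ℝ := fun n t =>
      ⟪u₀, e n⟫ * ML α 1 (-(lam n * t ^ α)) + ⟪u₁, e n⟫ * (t * ML α 2 (-(lam n * t ^ α)))
    let d : ℕ → ℝ → ℝ := fun n t =>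
      -(lam n * ⟪u₀, e n⟫ * (t ^ (α - 1) * ML α α (-(lam n * t ^ α)))) +
        ⟪u₁, e n⟫ * ML α 1 (-(lam n * t ^ α))
    ∀ v : H, (Summable fun n => lam n * ⟪v, e n⟫ ^ 2) →
      (∀ t ∈ Set.Icc (0 : ℝ) T,
        HasDerivWithinAt
          (fun s => ⟪riemannLiouville (2 - α) (fun τ => (∑' n, d n τ • e n) - u₁) s, v⟫)
          (-(∑' n, lam n * c n t * ⟪v, e n⟫)) (Set.Icc (0 : ℝ) T) t) ∧
      ContinuousOn (fun t => -(∑' n, lam n * c n t * ⟪v, e n⟫)) (Set.Icc (0 : ℝ) T) := by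
  intro c d v hv
  obtain ⟨D, hD0, hDα, hD2⟩ := ML_bounds hα1 hα2
  have hsq : ∀ n, √(lam n) ^ 2 = lam n := fun n => Real.sq_sqrt (hlam n).le
  have hp2 : Summable fun n => (√(lam n) * |⟪u₀, e n⟫|) ^ 2 :=
    hu₀.congr fun n => by rw [mul_pow, hsq, sq_abs]
  have hw2 : Summable fun n => (√(lam n) * |⟪v, e n⟫|) ^ 2 :=
    hv.congr fun n => by rw [mul_pow, hsq, sq_abs]
  have hr2 : Summable fun n => ⟪u₁, e n⟫ ^ 2 := inner_sq_summable e u₁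
  have hcc : ∀ n, Continuous (c n) := fun n => c_cont hα1
  have hdc : ∀ n, Continuous (d n) := fun n => d_cont hα1
  set K := D * T ^ (1 - α / 2) with hK
  set b : ℕ → ℝ := fun n => |√(lam n) * (|⟪u₀, e n⟫|)| * |√(lam n) * (|⟪v, e n⟫|)| +
    K * (|⟪u₁, e n⟫| * |√(lam n) * (|⟪v, e n⟫|)|) with hb
  have hbs : Summable b := (sq_summable_mul hp2 hw2).add ((sq_summable_mul hr2 hw2).mul_left _)
  have hcb : ∀ n, ∀ t ∈ Set.Icc (0 : ℝ) T, |lam n * c n t * ⟪v, e n⟫| ≤ b n := by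
    intro n t ht
    have h := c_bound (a0 := ⟪u₀, e n⟫) (a1 := ⟪u₁, e n⟫) hα1 hα2 (hlam n) hD0 hD2 ht.1 ht.2
    change √(lam n) * |c n t| ≤ _ at h
    have e1 : |√(lam n) * (|⟪u₀, e n⟫|)| = √(lam n) * |⟪u₀, e n⟫| := abs_of_nonneg (by positivity)
    have e2 : |√(lam n) * (|⟪v, e n⟫|)| = √(lam n) * |⟪v, e n⟫| := abs_of_nonneg (by positivity)
    simp only [hb, e1, e2]
    rw [abs_mul, abs_mul, abs_of_pos (hlam n)]
    calc lam n * |c n t| * |⟪v, e n⟫|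
        = (√(lam n) * |⟪v, e n⟫|) * (√(lam n) * |c n t|) := by
          linear_combination (-(|c n t| * |⟪v, e n⟫|)) * hsq n
      _ ≤ (√(lam n) * |⟪v, e n⟫|) * (√(lam n) * |⟪u₀, e n⟫| + K * |⟪u₁, e n⟫|) := by
          gcongr
      _ = _ := by ring
  have hS : ContinuousOn (fun t => ∑' n, lam n * c n t * ⟪v, e n⟫) (Set.Icc (0 : ℝ) T) :=
    continuousOn_tsum
      (fun n => ((continuous_const.mul (hcc n)).mul continuous_const).continuousOn) hbs
      (fun n t ht => hcb n t ht)
  have hq2 : Summable fun n => (D * (√(lam n) * |⟪u₀, e n⟫|)) ^ 2 :=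
    (hp2.mul_left (D ^ 2)).congr fun n => by rw [mul_pow D]
  have hkey : ∀ s ∈ Set.Icc (0 : ℝ) T,
      ⟪riemannLiouville (2 - α) (fun τ => (∑' n, d n τ • e n) - u₁) s, v⟫ =
        -∫ τ in (0 : ℝ)..s, ∑' n, lam n * c n τ * ⟪v, e n⟫ := by
    intro s hs
    rcases eq_or_lt_of_le hs.1 with h | h
    · rw [← h]; simp [riemannLiouville]
    rw [weak_int e (q := fun n => D * (√(lam n) * |⟪u₀, e n⟫|)) (ρ := α / 2) u₁ v
      (by linarith) (by linarith) h hdc (fun n => by positivity) hq2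
      (fun n τ hτ => d_bound hα1 hα2 (hlam n) hDα hτ)]
    rw [← int_tsum (c := fun n t => lam n * c n t * ⟪v, e n⟫) hs.1 hs.2
      (fun n => (continuous_const.mul (hcc n)).mul continuous_const) hbs hcb, ← tsum_neg]
    refine tsum_congr fun n => ?_
    rw [coef_identity hα1 hα2 hs.1, intervalIntegral.integral_mul_const,
      intervalIntegral.integral_const_mul]
    ring
  refine ⟨fun t ht => ?_, hS.neg⟩
  haveI : Fact (t ∈ Set.Icc (0 : ℝ) T) := ⟨ht⟩
  have hInt : IntervalIntegrable (fun t => ∑' n, lam n * c n t * ⟪v, e n⟫)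
      MeasureTheory.volume 0 t := by
    refine ContinuousOn.intervalIntegrable (hS.mono ?_)
    rw [Set.uIcc_of_le ht.1]
    exact Set.Icc_subset_Icc_right ht.2
  have hder := intervalIntegral.integral_hasDerivWithinAt_right (s := Set.Icc (0 : ℝ) T)
    (t := Set.Icc (0 : ℝ) T) hInt
    (hS.stronglyMeasurableAtFilter_nhdsWithin measurableSet_Icc t) (hS t ht)
  exact hder.neg.congr (fun s hs => hkey s hs) (hkey t ht)
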